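/- arXiv:1411.3169 — 5 statements merged into one kernel-verified Lean document; each statement's English description precedes it below -/
import Mathlib

section
/- For every λ ∈ ℝ and all α > 0, β > 0, the function x ↦ x^{λ−1} exp(−(β/2)(x/α + α/x)) is integrable on (0,∞), and its integral C(λ, α, β) = ∫₀^∞ x^{λ−1} exp(−(β/2)(x/α + α/x)) dx is strictly positive. Consequently the generalized inverse Gaussian kernel can be normalized to a probability density on (0,∞). -/
open MeasureTheory Real Set

/-- For `c, x > 0`, the factor `exp (-(c / x))` is bounded by a multiple of any power of `x`. -/
lemma exp_neg_div_le_factorial_div_pow_mul_pow {c x : ℝ} (hc : 0 < c) (hx : 0 < x) (n : ℕ) :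
    exp (-(c / x)) ≤ n.factorial / c ^ n * x ^ n := by
  have h := Real.pow_div_factorial_le_exp (c / x) (by positivity) n
  rw [exp_neg]
  refine (inv_anti₀ (by positivity) h).trans_eq ?_
  rw [div_pow]
  field_simp

/-- The kernel `x ^ s * exp (-(b * x + c / x))` is integrable on `(0, ∞)` for every real `s`. -/
lemma integrableOn_rpow_mul_exp_neg_add_div (s : ℝ) {b c : ℝ} (hb : 0 < b) (hc : 0 < c) :
    IntegrableOn (fun x : ℝ => x ^ s * exp (-(b * x + c / x))) (Ioi 0) := by
  obtain ⟨n, hn⟩ := exists_nat_ge (-s)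
  have hint := (integrableOn_rpow_mul_exp_neg_mul_rpow (s := s + n) (p := 1)
    (by linarith) one_pos hb).const_mul (n.factorial / c ^ n)
  refine Integrable.mono' hint (by fun_prop) ?_
  filter_upwards [ae_restrict_mem measurableSet_Ioi] with x (hx : 0 < x)
  rw [norm_of_nonneg (by positivity), neg_add, exp_add, rpow_add hx, rpow_natCast, rpow_one,
    neg_mul]
  calc x ^ s * (exp (-(b * x)) * exp (-(c / x)))
      ≤ x ^ s * (exp (-(b * x)) * (n.factorial / c ^ n * x ^ n)) := by
        gcongr
        exact exp_neg_div_le_factorial_div_pow_mul_pow hc hx n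
    _ = n.factorial / c ^ n * (x ^ s * x ^ n * exp (-(b * x))) := by ring

/-- For every `λ ∈ ℝ` and `α, β > 0`, the generalized inverse Gaussian
kernel `x ↦ x^(λ-1) * exp (-(β/2) * (x/α + α/x))` is integrable on `(0,∞)`, its
integral `C(λ, α, β)` is strictly positive, and consequently the kernel normalized
by `C(λ, α, β)` is a probability density on `(0,∞)`. -/
theorem gig_kernel_integrable_pos
    (lam α β : ℝ) (hα : 0 < α) (hβ : 0 < β) :
    IntegrableOn
      (fun x : ℝ => x ^ (lam - 1) * exp (-(β / 2) * (x / α + α / x))) (Ioi 0)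
    ∧ 0 < ∫ x in Ioi (0:ℝ), x ^ (lam - 1) * exp (-(β / 2) * (x / α + α / x))
    ∧ ∫ x in Ioi (0:ℝ),
        (x ^ (lam - 1) * exp (-(β / 2) * (x / α + α / x))
          / ∫ y in Ioi (0:ℝ), y ^ (lam - 1) * exp (-(β / 2) * (y / α + α / y)))
        = 1 := by
  have hint : IntegrableOn
      (fun x : ℝ => x ^ (lam - 1) * exp (-(β / 2) * (x / α + α / x))) (Ioi 0) := by
    convert integrableOn_rpow_mul_exp_neg_add_div (lam - 1) (b := β / (2 * α))
      (c := β * α / 2) (by positivity) (by positivity) using 4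
    ring
  have hpos_on : ∀ x ∈ Ioi (0 : ℝ),
      0 < x ^ (lam - 1) * exp (-(β / 2) * (x / α + α / x)) :=
    fun x hx => mul_pos (rpow_pos_of_pos hx _) (exp_pos _)
  have hpos : 0 < ∫ x in Ioi (0 : ℝ), x ^ (lam - 1) * exp (-(β / 2) * (x / α + α / x)) := by
    rw [setIntegral_pos_iff_support_of_nonneg_ae _ hint]
    · rw [inter_eq_right.mpr fun x hx => Function.mem_support.mpr (hpos_on x hx).ne']
      simp
    · filter_upwards [ae_restrict_mem measurableSet_Ioi] with x hx using (hpos_on x hx).le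
  refine ⟨hint, hpos, ?_⟩
  rw [integral_div, div_self hpos.ne']
end

section
/- Let a > 0 and b > 0 and let f₀ be the gamma density f₀(x) = (b^a / Γ(a)) x^{a−1} e^{−bx} on (0,∞). Then for every probability density f on (0,∞) such that x·f(x), (ln x)·f(x) and f(x)·ln f(x) are integrable on (0,∞), with the same arithmetic mean (∫₀^∞ x f = ∫₀^∞ x f₀) and the same geometric-mean constraint (∫₀^∞ ln x · f = ∫₀^∞ ln x · f₀) as f₀, the differential entropy satisfies −∫₀^∞ f(x) ln f(x) dx ≤ −∫₀^∞ f₀(x) ln f₀(x) dx. That is, the maximum-entropy density on (0,∞) under conservation of the arithmetic and geometric means is the gamma distribution. -/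
open MeasureTheory Real Set

/-- The pointwise form of the nonnegativity of relative entropy. -/
lemma sub_le_mul_log_sub_mul_log {t s : ℝ} (ht : 0 ≤ t) (hs : 0 < s) :
    t - s ≤ t * Real.log t - t * Real.log s := by
  rcases ht.eq_or_lt with rfl | ht
  · simp [hs.le]
  · have h := mul_le_mul_of_nonneg_left (Real.log_le_sub_one_of_pos (div_pos hs ht)) ht.le
    rw [Real.log_div hs.ne' ht.ne', mul_sub, mul_sub, mul_div_cancel₀ _ ht.ne'] at h
    linarith

lemma abs_log_le_rpow_add_rpow_neg {x ε : ℝ} (hx : 0 < x) (hε : 0 < ε) :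
    |Real.log x| ≤ (x ^ ε + x ^ (-ε)) / ε := by
  have h1 := Real.log_le_rpow_div hx.le hε
  have h2 := Real.log_le_rpow_div (inv_pos.2 hx).le hε
  rw [Real.log_inv, Real.inv_rpow hx.le, ← Real.rpow_neg hx.le] at h2
  have h3 : 0 ≤ x ^ ε / ε := by positivity
  have h4 : 0 ≤ x ^ (-ε) / ε := by positivity
  rw [add_div]
  exact abs_le.2 ⟨by linarith, by linarith⟩

lemma integrableOn_rpow_mul_exp_neg_mul {s b : ℝ} (hs : -1 < s) (hb : 0 < b) :
    IntegrableOn (fun x : ℝ => x ^ s * exp (-b * x)) (Ioi 0) := by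
  simpa using integrableOn_rpow_mul_exp_neg_mul_rpow hs one_pos hb

lemma integrableOn_log_mul_rpow_mul_exp_neg_mul {a b : ℝ} (ha : 0 < a) (hb : 0 < b) :
    IntegrableOn (fun x : ℝ => Real.log x * (x ^ (a - 1) * exp (-b * x))) (Ioi 0) := by
  have h1 := integrableOn_rpow_mul_exp_neg_mul (s := a / 2 + (a - 1)) (by linarith) hb
  have h2 := integrableOn_rpow_mul_exp_neg_mul (s := -(a / 2) + (a - 1)) (by linarith) hb
  refine Integrable.mono' ((h1.add h2).div_const (a / 2))
    (by fun_prop : Measurable _).aestronglyMeasurable ?_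
  refine (ae_restrict_iff' measurableSet_Ioi).2 (ae_of_all _ fun x hx => ?_)
  have hx : 0 < x := hx
  have h := mul_le_mul_of_nonneg_right (abs_log_le_rpow_add_rpow_neg hx (half_pos ha))
    (by positivity : 0 ≤ x ^ (a - 1) * exp (-b * x))
  rw [Real.norm_eq_abs, abs_mul, abs_of_nonneg (by positivity : 0 ≤ x ^ (a - 1) * exp (-b * x))]
  refine h.trans_eq ?_
  simp only [Pi.add_apply, Real.rpow_add hx]
  ring

/-- The integral of a function against the logarithm of a gamma density, in terms of its mass and
its arithmetic and logarithmic moments. -/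
lemma integral_affine_log_mul {g : ℝ → ℝ} (c p b : ℝ) (h0 : IntegrableOn g (Ioi 0))
    (h1 : IntegrableOn (fun x : ℝ => x * g x) (Ioi 0))
    (h2 : IntegrableOn (fun x : ℝ => Real.log x * g x) (Ioi 0)) :
    IntegrableOn (fun x : ℝ => g x * (c + p * Real.log x - b * x)) (Ioi 0) ∧
      ∫ x in Ioi (0:ℝ), g x * (c + p * Real.log x - b * x)
        = c * (∫ x in Ioi (0:ℝ), g x) + p * (∫ x in Ioi (0:ℝ), Real.log x * g x)
          - b * ∫ x in Ioi (0:ℝ), x * g x := by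
  have e : (fun x : ℝ => g x * (c + p * Real.log x - b * x))
      = fun x => c * g x + p * (Real.log x * g x) - b * (x * g x) := by
    funext x
    ring
  have i0 := h0.const_mul c
  have i1 := h1.const_mul b
  have i2 := h2.const_mul p
  rw [e]
  have i02 : IntegrableOn (fun x : ℝ => c * g x + p * (Real.log x * g x)) (Ioi 0) := i0.add i2
  refine ⟨i02.sub i1, ?_⟩
  rw [integral_sub i02 i1, integral_add i0 i2, integral_const_mul, integral_const_mul,
    integral_const_mul]

/-- The maximum-entropy density on `(0,∞)` under conservation of the
arithmetic and geometric means is the gamma distribution: for every probability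
density `f` on `(0,∞)` with the same arithmetic mean and the same geometric-mean
constraint as the gamma density `f₀ x = (b^a / Γ(a)) * x^(a-1) * exp (-b*x)`,
the differential entropy of `f` is at most that of `f₀`. -/
theorem gamma_maximizes_entropy
    (a b : ℝ) (ha : 0 < a) (hb : 0 < b)
    (f₀ : ℝ → ℝ)
    (hf₀_def : ∀ x ∈ Ioi (0:ℝ),
      f₀ x = b ^ a / Real.Gamma a * (x ^ (a - 1) * exp (-b * x)))
    (f : ℝ → ℝ) (hf_meas : Measurable f) (hf_nonneg : ∀ x ∈ Ioi (0:ℝ), 0 ≤ f x)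
    (hf_norm : ∫ x in Ioi (0:ℝ), f x = 1)
    (hf_int₁ : IntegrableOn (fun x : ℝ => x * f x) (Ioi 0))
    (hf_int₂ : IntegrableOn (fun x : ℝ => Real.log x * f x) (Ioi 0))
    (hf_int₃ : IntegrableOn (fun x : ℝ => f x * Real.log (f x)) (Ioi 0))
    (h_arith : ∫ x in Ioi (0:ℝ), x * f x = ∫ x in Ioi (0:ℝ), x * f₀ x)
    (h_geom : ∫ x in Ioi (0:ℝ), Real.log x * f x
      = ∫ x in Ioi (0:ℝ), Real.log x * f₀ x) :
    -∫ x in Ioi (0:ℝ), f x * Real.log (f x)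
      ≤ -∫ x in Ioi (0:ℝ), f₀ x * Real.log (f₀ x) := by
  have hG := Real.Gamma_pos_of_pos ha
  have hK : 0 < b ^ a / Real.Gamma a := by positivity
  have hpos : ∀ x ∈ Ioi (0:ℝ), 0 < f₀ x := fun x hx => by
    have hx' : 0 < x := hx
    rw [hf₀_def x hx]
    positivity
  have hlog : ∀ x ∈ Ioi (0:ℝ), Real.log (f₀ x)
      = Real.log (b ^ a / Real.Gamma a) + (a - 1) * Real.log x - b * x := fun x hx => by
    have hx' : 0 < x := hx
    rw [hf₀_def x hx, Real.log_mul hK.ne' (by positivity), Real.log_mul (by positivity)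
      (by positivity), Real.log_rpow hx', Real.log_exp]
    ring
  have hf_int : IntegrableOn f (Ioi 0) := by
    by_contra h
    rw [integral_undef h] at hf_norm
    exact zero_ne_one hf_norm
  have hf₀_int : IntegrableOn f₀ (Ioi 0) :=
    IntegrableOn.congr_fun
      ((integrableOn_rpow_mul_exp_neg_mul (by linarith : -1 < a - 1) hb).const_mul _)
      (fun x hx => (hf₀_def x hx).symm) measurableSet_Ioi
  have hf₀_int₁ : IntegrableOn (fun x : ℝ => x * f₀ x) (Ioi 0) := by
    refine IntegrableOn.congr_fun
      ((integrableOn_rpow_mul_exp_neg_mul (by linarith : -1 < a) hb).const_mul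
        (b ^ a / Real.Gamma a)) (fun x hx => ?_) measurableSet_Ioi
    have hx' : 0 < x := hx
    simp only [hf₀_def x hx, Real.rpow_sub_one hx'.ne']
    field_simp
  have hf₀_int₂ : IntegrableOn (fun x : ℝ => Real.log x * f₀ x) (Ioi 0) := by
    refine IntegrableOn.congr_fun
      ((integrableOn_log_mul_rpow_mul_exp_neg_mul ha hb).const_mul
        (b ^ a / Real.Gamma a)) (fun x hx => ?_) measurableSet_Ioi
    simp only [hf₀_def x hx]
    ring
  have hf₀_norm : ∫ x in Ioi (0:ℝ), f₀ x = 1 := by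
    rw [setIntegral_congr_fun measurableSet_Ioi hf₀_def, integral_const_mul]
    simp only [neg_mul]
    rw [Real.integral_rpow_mul_exp_neg_mul_Ioi ha hb, Real.div_rpow zero_le_one hb.le,
      Real.one_rpow]
    field_simp
  obtain ⟨hi, he⟩ := integral_affine_log_mul (Real.log (b ^ a / Real.Gamma a)) (a - 1) b
    hf_int hf_int₁ hf_int₂
  obtain ⟨-, he₀⟩ := integral_affine_log_mul (Real.log (b ^ a / Real.Gamma a)) (a - 1) b
    hf₀_int hf₀_int₁ hf₀_int₂
  have key : ∫ x in Ioi (0:ℝ), (f x - f₀ x) ≤ ∫ x in Ioi (0:ℝ), (f x * Real.log (f x)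
      - f x * (Real.log (b ^ a / Real.Gamma a) + (a - 1) * Real.log x - b * x)) := by
    refine setIntegral_mono_on (hf_int.sub hf₀_int) (hf_int₃.sub hi) measurableSet_Ioi
      fun x hx => ?_
    rw [← hlog x hx]
    exact sub_le_mul_log_sub_mul_log (hf_nonneg x hx) (hpos x hx)
  rw [integral_sub hf_int hf₀_int, integral_sub hf_int₃ hi, hf_norm, hf₀_norm, he, hf_norm,
    h_arith, h_geom] at key
  rw [hf₀_norm] at he₀
  have hent : ∫ x in Ioi (0:ℝ), f₀ x * Real.log (f₀ x) = ∫ x in Ioi (0:ℝ),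
      f₀ x * (Real.log (b ^ a / Real.Gamma a) + (a - 1) * Real.log x - b * x) :=
    setIntegral_congr_fun measurableSet_Ioi fun x hx => by simp only [hlog x hx]
  rw [hent, he₀]
  linarith
end

section
/- Let a > 0 and b > 0 and let f₀ be the inverse gamma density f₀(x) = (b^a / Γ(a)) x^{−a−1} e^{−b/x} on (0,∞). Then for every probability density f on (0,∞) such that x⁻¹·f(x), (ln x)·f(x) and f(x)·ln f(x) are integrable on (0,∞), with the same harmonic-mean constraint (∫₀^∞ x⁻¹ f = ∫₀^∞ x⁻¹ f₀) and the same geometric-mean constraint (∫₀^∞ ln x · f = ∫₀^∞ ln x · f₀) as f₀, the differential entropy satisfies −∫₀^∞ f(x) ln f(x) dx ≤ −∫₀^∞ f₀(x) ln f₀(x) dx. That is, the maximum-entropy density on (0,∞) under conservation of the harmonic and geometric means is the inverse gamma distribution. -/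
open MeasureTheory Real Set

/-- The substitution `y = x⁻¹` turns the gamma kernel into the inverse gamma kernel. -/
lemma rpow_inv_mul_gamma_kernel (s b : ℝ) {x : ℝ} (hx : 0 < x) :
    x ^ ((-1 : ℝ) - 1) * ((x ^ (-1 : ℝ)) ^ (s - 1) * exp (-(b * x ^ (-1 : ℝ)))) =
      x ^ (-s - 1) * exp (-b / x) := by
  rw [← rpow_mul hx.le, ← mul_assoc, ← rpow_add hx, rpow_neg_one, neg_div, div_eq_mul_inv]
  ring_nf

lemma integral_inverse_gamma_kernel {s b : ℝ} (hs : 0 < s) (hb : 0 < b) :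
    ∫ x in Ioi (0 : ℝ), x ^ (-s - 1) * exp (-b / x) = Real.Gamma s / b ^ s := by
  have key := integral_comp_rpow_Ioi (fun y : ℝ => y ^ (s - 1) * exp (-(b * y)))
    (p := -1) (by norm_num)
  rw [integral_rpow_mul_exp_neg_mul_Ioi hs hb] at key
  rw [one_div, inv_rpow hb.le, mul_comm, ← div_eq_mul_inv] at key
  rw [← key]
  refine setIntegral_congr_fun measurableSet_Ioi fun x hx => ?_
  simp only [abs_neg, abs_one, one_mul, smul_eq_mul]
  exact (rpow_inv_mul_gamma_kernel s b hx).symm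

lemma integrableOn_inverse_gamma_kernel {s b : ℝ} (hs : 0 < s) (hb : 0 < b) :
    IntegrableOn (fun x : ℝ => x ^ (-s - 1) * exp (-b / x)) (Ioi 0) := by
  refine Integrable.of_integral_ne_zero ?_
  rw [integral_inverse_gamma_kernel hs hb]
  exact (div_pos (Gamma_pos_of_pos hs) (rpow_pos_of_pos hb s)).ne'

lemma integrableOn_inv_mul_inverse_gamma_kernel {s b : ℝ} (hs : 0 < s) (hb : 0 < b) :
    IntegrableOn (fun x : ℝ => x⁻¹ * (x ^ (-s - 1) * exp (-b / x))) (Ioi 0) := by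
  refine (integrableOn_inverse_gamma_kernel (s := s + 1) (by linarith) hb).congr_fun
    (fun x hx => ?_) measurableSet_Ioi
  have hx : 0 < x := hx
  dsimp only
  rw [← mul_assoc, ← rpow_neg_one, ← rpow_add hx]
  ring_nf

lemma abs_log_le_rpow_add_rpow_neg_div {x ε : ℝ} (hx : 0 < x) (hε : 0 < ε) :
    |log x| ≤ ε⁻¹ * (x ^ ε + x ^ (-ε)) := by
  have upper := log_le_rpow_div hx.le hε
  have lower := log_le_rpow_div (inv_pos.2 hx).le hε
  rw [log_inv, inv_rpow hx.le, ← rpow_neg hx.le] at lower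
  have h₁ : 0 ≤ x ^ ε / ε := by positivity
  have h₂ : 0 ≤ x ^ (-ε) / ε := by positivity
  have h₃ : ε⁻¹ * (x ^ ε + x ^ (-ε)) = x ^ ε / ε + x ^ (-ε) / ε := by ring
  rw [h₃, abs_le]
  constructor <;> linarith

lemma integrableOn_log_mul_inverse_gamma_kernel {s b : ℝ} (hs : 0 < s) (hb : 0 < b) :
    IntegrableOn (fun x : ℝ => log x * (x ^ (-s - 1) * exp (-b / x))) (Ioi 0) := by
  have dominating := ((integrableOn_inverse_gamma_kernel (s := s - s / 2) (by linarith) hb).add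
    (integrableOn_inverse_gamma_kernel (s := s + s / 2) (by linarith) hb)).const_mul (s / 2)⁻¹
  refine Integrable.mono' dominating (by fun_prop) ?_
  filter_upwards [ae_restrict_mem measurableSet_Ioi] with x hx
  have hx : 0 < x := hx
  have hk : 0 ≤ x ^ (-s - 1) * exp (-b / x) := by positivity
  rw [norm_mul, norm_of_nonneg hk, norm_eq_abs]
  refine (mul_le_mul_of_nonneg_right
    (abs_log_le_rpow_add_rpow_neg_div hx (half_pos hs)) hk).trans_eq ?_
  have h₁ : x ^ (-(s - s / 2) - 1) = x ^ (s / 2) * x ^ (-s - 1) := by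
    rw [← rpow_add hx]; ring_nf
  have h₂ : x ^ (-(s + s / 2) - 1) = x ^ (-(s / 2)) * x ^ (-s - 1) := by
    rw [← rpow_add hx]; ring_nf
  simp only [Pi.add_apply, h₁, h₂]
  ring

lemma log_const_mul_inverse_gamma_kernel {c : ℝ} (hc : 0 < c) (s b : ℝ) {x : ℝ} (hx : 0 < x) :
    log (c * (x ^ (-s - 1) * exp (-b / x))) = log c + (-s - 1) * log x - b * x⁻¹ := by
  have hp := rpow_pos_of_pos hx (-s - 1)
  rw [log_mul hc.ne' (by positivity), log_mul hp.ne' (exp_pos _).ne', log_rpow hx, log_exp]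
  ring

/-- Pointwise form of Gibbs' inequality. -/
lemma mul_log_le_mul_log_add_sub {p q : ℝ} (hp : 0 ≤ p) (hq : 0 < q) :
    p * log q ≤ p * log p + (q - p) := by
  rcases hp.eq_or_lt with rfl | hp
  · simpa using hq.le
  · have h := mul_le_mul_of_nonneg_left (log_le_sub_one_of_pos (div_pos hq hp)) hp.le
    rw [log_div hq.ne' hp.ne', mul_sub, mul_sub, mul_div_cancel₀ _ hp.ne'] at h
    linarith

/-- Gibbs' inequality for two densities with respect to `μ`. -/
lemma integral_mul_log_le_integral_mul_log {α : Type*} [MeasurableSpace α] {μ : Measure α}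
    {f g : α → ℝ} (hf : Integrable f μ) (hg : Integrable g μ)
    (hf_nonneg : ∀ᵐ x ∂μ, 0 ≤ f x) (hg_pos : ∀ᵐ x ∂μ, 0 < g x)
    (hfg : ∫ x, f x ∂μ = ∫ x, g x ∂μ)
    (hff : Integrable (fun x => f x * log (f x)) μ)
    (hf_log_g : Integrable (fun x => f x * log (g x)) μ) :
    ∫ x, f x * log (g x) ∂μ ≤ ∫ x, f x * log (f x) ∂μ := by
  have h : ∫ x, f x * log (g x) ∂μ ≤ ∫ x, (f x * log (f x) + (g x - f x)) ∂μ := by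
    refine integral_mono_ae hf_log_g (hff.add (hg.sub hf)) ?_
    filter_upwards [hf_nonneg, hg_pos] with x hp hq using mul_log_le_mul_log_add_sub hp hq
  have hsub : Integrable (fun x => g x - f x) μ := hg.sub hf
  rwa [integral_add hff hsub, integral_sub hg hf, hfg, sub_self, add_zero] at h

lemma integrable_and_integral_mul_affine_log_inv {μ : Measure ℝ} {g : ℝ → ℝ} (c d b : ℝ)
    (hg : Integrable g μ) (hg_log : Integrable (fun x => log x * g x) μ)
    (hg_inv : Integrable (fun x => x⁻¹ * g x) μ) :
    Integrable (fun x => g x * (c + d * log x - b * x⁻¹)) μ ∧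
      ∫ x, g x * (c + d * log x - b * x⁻¹) ∂μ =
        c * ∫ x, g x ∂μ + d * ∫ x, log x * g x ∂μ - b * ∫ x, x⁻¹ * g x ∂μ := by
  have expand : (fun x => g x * (c + d * log x - b * x⁻¹)) =
      fun x => c * g x + d * (log x * g x) - b * (x⁻¹ * g x) := by
    ext x; ring
  have h₁ := hg.const_mul c
  have h₂ := hg_log.const_mul d
  have h₃ := hg_inv.const_mul b
  have h₁₂ : Integrable (fun x => c * g x + d * (log x * g x)) μ := h₁.add h₂
  rw [expand]
  refine ⟨h₁₂.sub h₃, ?_⟩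
  rw [integral_sub h₁₂ h₃, integral_add h₁ h₂, integral_const_mul, integral_const_mul,
    integral_const_mul]

/-- The maximum-entropy density on `(0,∞)` under conservation of the
harmonic and geometric means is the inverse gamma distribution: for every probability
density `f` on `(0,∞)` with the same harmonic-mean constraint and the same
geometric-mean constraint as the inverse gamma density
`f₀ x = (b^a / Γ(a)) * x^(-a-1) * exp (-b/x)`, the differential entropy of `f`
is at most that of `f₀`. -/
theorem inverse_gamma_maximizes_entropy
    (a b : ℝ) (ha : 0 < a) (hb : 0 < b)
    (f₀ : ℝ → ℝ)
    (hf₀_def : ∀ x ∈ Ioi (0:ℝ),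
      f₀ x = b ^ a / Real.Gamma a * (x ^ (-a - 1) * exp (-b / x)))
    (f : ℝ → ℝ) (hf_meas : Measurable f) (hf_nonneg : ∀ x ∈ Ioi (0:ℝ), 0 ≤ f x)
    (hf_norm : ∫ x in Ioi (0:ℝ), f x = 1)
    (hf_int₁ : IntegrableOn (fun x : ℝ => x⁻¹ * f x) (Ioi 0))
    (hf_int₂ : IntegrableOn (fun x : ℝ => Real.log x * f x) (Ioi 0))
    (hf_int₃ : IntegrableOn (fun x : ℝ => f x * Real.log (f x)) (Ioi 0))
    (h_harm : ∫ x in Ioi (0:ℝ), x⁻¹ * f x = ∫ x in Ioi (0:ℝ), x⁻¹ * f₀ x)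
    (h_geom : ∫ x in Ioi (0:ℝ), Real.log x * f x
      = ∫ x in Ioi (0:ℝ), Real.log x * f₀ x) :
    -∫ x in Ioi (0:ℝ), f x * Real.log (f x)
      ≤ -∫ x in Ioi (0:ℝ), f₀ x * Real.log (f₀ x) := by
  have hc : 0 < b ^ a / Real.Gamma a :=
    div_pos (rpow_pos_of_pos hb a) (Gamma_pos_of_pos ha)
  set c := b ^ a / Real.Gamma a with hc_def
  have f₀_pos : ∀ x ∈ Ioi (0 : ℝ), 0 < f₀ x := fun x hx => by
    have := rpow_pos_of_pos hx (-a - 1)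
    rw [hf₀_def x hx]
    positivity
  have mul_log_f₀ (g : ℝ → ℝ) : EqOn (fun x => g x * log (f₀ x))
      (fun x => g x * (log c + (-a - 1) * log x - b * x⁻¹)) (Ioi 0) := fun x hx => by
    simp only [hf₀_def x hx, log_const_mul_inverse_gamma_kernel hc a b hx]
  have f₀_integrable : IntegrableOn f₀ (Ioi 0) :=
    IntegrableOn.congr_fun ((integrableOn_inverse_gamma_kernel ha hb).const_mul c)
      (fun x hx => (hf₀_def x hx).symm) measurableSet_Ioi
  have inv_f₀_integrable : IntegrableOn (fun x => x⁻¹ * f₀ x) (Ioi 0) :=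
    IntegrableOn.congr_fun ((integrableOn_inv_mul_inverse_gamma_kernel ha hb).const_mul c)
      (fun x hx => by rw [hf₀_def x hx]; ring) measurableSet_Ioi
  have log_f₀_integrable : IntegrableOn (fun x => log x * f₀ x) (Ioi 0) :=
    IntegrableOn.congr_fun ((integrableOn_log_mul_inverse_gamma_kernel ha hb).const_mul c)
      (fun x hx => by rw [hf₀_def x hx]; ring) measurableSet_Ioi
  have f₀_norm : ∫ x in Ioi (0 : ℝ), f₀ x = 1 := by
    rw [setIntegral_congr_fun measurableSet_Ioi hf₀_def, integral_const_mul,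
      integral_inverse_gamma_kernel ha hb, hc_def]
    have := (Gamma_pos_of_pos ha).ne'
    have := (rpow_pos_of_pos hb a).ne'
    field_simp
  have f_integrable : IntegrableOn f (Ioi 0) :=
    Integrable.of_integral_ne_zero (by rw [hf_norm]; exact one_ne_zero)
  obtain ⟨cross_integrable, cross_eq⟩ := integrable_and_integral_mul_affine_log_inv
    (log c) (-a - 1) b f_integrable hf_int₂ hf_int₁
  obtain ⟨-, self_eq⟩ := integrable_and_integral_mul_affine_log_inv
    (log c) (-a - 1) b f₀_integrable log_f₀_integrable inv_f₀_integrable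
  have entropy_eq : ∫ x in Ioi (0 : ℝ), f₀ x * log (f₀ x) =
      ∫ x in Ioi (0 : ℝ), f x * log (f₀ x) := by
    rw [setIntegral_congr_fun measurableSet_Ioi (mul_log_f₀ f₀),
      setIntegral_congr_fun measurableSet_Ioi (mul_log_f₀ f),
      cross_eq, self_eq, hf_norm, f₀_norm, h_harm, h_geom]
  rw [neg_le_neg_iff, entropy_eq]
  exact integral_mul_log_le_integral_mul_log f_integrable f₀_integrable
    (ae_restrict_of_forall_mem measurableSet_Ioi hf_nonneg)
    (ae_restrict_of_forall_mem measurableSet_Ioi f₀_pos) (hf_norm.trans f₀_norm.symm) hf_int₃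
    (IntegrableOn.congr_fun cross_integrable (mul_log_f₀ f).symm measurableSet_Ioi)
end

section
/- For all a > 0 and b > 0, ∫₀^∞ x^{−1/2} exp(−a x − b/x) dx = √(π/a) · exp(−2√(ab)). (This is the normalization of the reciprocal inverse Gaussian density, the λ = 1/2 member of the generalized inverse Gaussian family.) -/
open MeasureTheory Real Set

/-- Substitution `y = c / x` in integrals over `Ioi 0`. -/
theorem integral_comp_const_div_Ioi {E : Type*} [NormedAddCommGroup E] [NormedSpace ℝ E]
    (g : ℝ → E) {c : ℝ} (hc : 0 < c) :
    ∫ x in Ioi (0:ℝ), (c / x ^ 2) • g (c / x) = ∫ y in Ioi (0:ℝ), g y := by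
  have himage : (fun x : ℝ => c / x) '' Ioi 0 = Ioi 0 := by
    ext y
    constructor
    · rintro ⟨x, hx, rfl⟩
      exact div_pos hc hx
    · intro hy
      exact ⟨c / y, div_pos hc hy, div_div_cancel₀ hc.ne'⟩
  have hderiv : ∀ x ∈ Ioi (0:ℝ),
      HasDerivWithinAt (fun x : ℝ => c / x) (-(c / x ^ 2)) (Ioi 0) x := by
    intro x hx
    have h := ((hasDerivAt_inv (ne_of_gt hx)).const_mul c).hasDerivWithinAt (s := Ioi 0)
    simpa only [div_eq_mul_inv, mul_neg] using h
  have hinj : InjOn (fun x : ℝ => c / x) (Ioi 0) := by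
    intro x _ y _ hxy
    simpa [div_eq_mul_inv, hc.ne'] using hxy
  have h := integral_image_eq_integral_abs_deriv_smul measurableSet_Ioi hderiv hinj g
  rw [himage] at h
  rw [h]
  refine setIntegral_congr_fun measurableSet_Ioi fun x hx => ?_
  simp only [abs_neg, abs_of_pos (div_pos hc (pow_pos (mem_Ioi.mp hx) 2))]

section CauchySchlomilch

variable {p q : ℝ}

theorem strictMonoOn_mul_sub_div (hp : 0 < p) (hq : 0 < q) :
    StrictMonoOn (fun x : ℝ => p * x - q / x) (Ioi 0) := by
  intro x hx y _ hxy
  have h₁ : p * x < p * y := mul_lt_mul_of_pos_left hxy hp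
  have h₂ : q / y < q / x := div_lt_div_of_pos_left hq hx hxy
  change p * x - q / x < p * y - q / y
  linarith

theorem image_mul_sub_div_Ioi (hp : 0 < p) (hq : 0 < q) :
    (fun x : ℝ => p * x - q / x) '' Ioi 0 = univ := by
  refine eq_univ_of_forall fun y => ?_
  have hs : √(y ^ 2 + 4 * p * q) ^ 2 = y ^ 2 + 4 * p * q := sq_sqrt (by positivity)
  have hlt : |y| < √(y ^ 2 + 4 * p * q) := by
    rw [← sqrt_sq_eq_abs]
    exact sqrt_lt_sqrt (sq_nonneg y) (by nlinarith [mul_pos hp hq])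
  have hpos : 0 < y + √(y ^ 2 + 4 * p * q) := by linarith [neg_abs_le y]
  refine ⟨(y + √(y ^ 2 + 4 * p * q)) / (2 * p), div_pos hpos (by positivity), ?_⟩
  set s := √(y ^ 2 + 4 * p * q)
  have hne : y + s ≠ 0 := hpos.ne'
  have hpq : q = (s ^ 2 - y ^ 2) / (4 * p) := by
    rw [hs]
    field_simp
    ring
  simp only
  rw [hpq]
  field_simp
  ring

theorem hasDerivAt_mul_sub_div {x : ℝ} (hx : x ≠ 0) :
    HasDerivAt (fun x : ℝ => p * x - q / x) (p + q / x ^ 2) x := by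
  have h := ((hasDerivAt_id x).const_mul p).sub ((hasDerivAt_inv hx).const_mul q)
  convert! h using 1
  simp [div_eq_mul_inv]

/-- The Cauchy–Schlömilch transformation. -/
theorem integral_comp_mul_sub_div_Ioi (hp : 0 < p) (hq : 0 < q) {g : ℝ → ℝ}
    (hg : Integrable g) (heven : Function.Even g) :
    ∫ x in Ioi (0:ℝ), g (p * x - q / x) = (2 * p)⁻¹ * ∫ y, g y := by
  have hderiv : ∀ x ∈ Ioi (0:ℝ),
      HasDerivWithinAt (fun x : ℝ => p * x - q / x) (p + q / x ^ 2) (Ioi 0) x :=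
    fun x hx => (hasDerivAt_mul_sub_div (ne_of_gt hx)).hasDerivWithinAt
  have hinj := (strictMonoOn_mul_sub_div hp hq).injOn
  have hpos : ∀ x : ℝ, 0 < p + q / x ^ 2 := fun x => by positivity
  have hint := integrableOn_image_iff_integrableOn_abs_deriv_smul measurableSet_Ioi hderiv hinj g
  have heq := integral_image_eq_integral_abs_deriv_smul measurableSet_Ioi hderiv hinj g
  simp only [image_mul_sub_div_Ioi hp hq, abs_of_pos (hpos _), smul_eq_mul, integrableOn_univ,
    setIntegral_univ] at hint heq
  have hfull := hint.mp hg
  have hcomp : IntegrableOn (fun x => g (p * x - q / x)) (Ioi 0) := by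
    have h : IntegrableOn (fun x => (p + q / x ^ 2)⁻¹ * ((p + q / x ^ 2) * g (p * x - q / x)))
        (Ioi 0) := by
      refine Integrable.bdd_mul (c := p⁻¹) hfull
        (by measurability : Measurable fun x : ℝ => (p + q / x ^ 2)⁻¹).aestronglyMeasurable
        (.of_forall fun x => ?_)
      rw [norm_of_nonneg (inv_nonneg.mpr (hpos x).le)]
      exact inv_anti₀ hp (le_add_of_nonneg_right (by positivity))
    simpa only [inv_mul_cancel_left₀ (hpos _).ne'] using h
  have hrefl : ∫ x in Ioi (0:ℝ), q / x ^ 2 * g (p * x - q / x)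
      = p * ∫ x in Ioi (0:ℝ), g (p * x - q / x) := by
    rw [← integral_comp_const_div_Ioi (fun x => g (p * x - q / x)) (div_pos hq hp),
      ← integral_const_mul]
    refine setIntegral_congr_fun measurableSet_Ioi fun x hx => ?_
    have hx : x ≠ 0 := ne_of_gt hx
    have harg : p * (q / p / x) - q / (q / p / x) = -(p * x - q / x) := by
      field_simp
      ring
    simp only [smul_eq_mul]
    rw [harg, heven]
    field_simp
  have hrefl_int : IntegrableOn (fun x => q / x ^ 2 * g (p * x - q / x)) (Ioi 0) :=
    (hfull.sub (hcomp.const_mul p)).congr (.of_forall fun x => by simp only [Pi.sub_apply]; ring)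
  simp only [add_mul] at heq
  rw [integral_add (hcomp.const_mul p) hrefl_int, integral_const_mul, hrefl] at heq
  rw [heq]
  field_simp
  ring

end CauchySchlomilch

/-- Normalization of the reciprocal inverse Gaussian density (the
`λ = 1/2` member of the generalized inverse Gaussian family): for all `a, b > 0`,
`∫₀^∞ x^(-1/2) exp (-a x - b/x) dx = √(π/a) exp (-2 √(a b))`. -/
theorem reciprocal_inverse_gaussian_normalization
    (a b : ℝ) (ha : 0 < a) (hb : 0 < b) :
    ∫ x in Ioi (0:ℝ), x ^ (-(1:ℝ) / 2) * exp (-a * x - b / x)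
      = Real.sqrt (π / a) * exp (-2 * Real.sqrt (a * b)) := by
  have hgauss := integral_comp_mul_sub_div_Ioi (sqrt_pos.mpr ha) (sqrt_pos.mpr hb)
    (integrable_exp_neg_mul_sq one_pos) (fun x => by simp)
  rw [integral_gaussian, div_one] at hgauss
  rw [← integral_comp_rpow_Ioi_of_pos two_pos]
  have hsubst : ∀ t ∈ Ioi (0:ℝ),
      (2 * t ^ ((2:ℝ) - 1)) • ((t ^ (2:ℝ)) ^ (-(1:ℝ) / 2) * exp (-a * t ^ (2:ℝ) - b / t ^ (2:ℝ)))
        = 2 * exp (-2 * √(a * b)) * exp (-1 * (√a * t - √b / t) ^ 2) := by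
    intro t ht
    have ht : 0 < t := ht
    have hpow : (t ^ (2:ℝ)) ^ (-(1:ℝ) / 2) = t⁻¹ := by
      rw [← rpow_mul ht.le, ← rpow_neg_one]
      norm_num
    have hexp : -a * t ^ 2 - b / t ^ 2 = -2 * √(a * b) + -1 * (√a * t - √b / t) ^ 2 := by
      rw [sqrt_mul ha.le, sub_sq, mul_pow, div_pow, sq_sqrt ha.le, sq_sqrt hb.le]
      field_simp
      ring
    rw [hpow, rpow_two, hexp, exp_add, show (2:ℝ) - 1 = 1 by norm_num, rpow_one, smul_eq_mul]
    field_simp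
  rw [setIntegral_congr_fun measurableSet_Ioi hsubst, integral_const_mul, hgauss,
    sqrt_div pi_pos.le]
  field_simp
end

section
/- Let λ ∈ ℝ, α > 0, β > 0, let C(λ, α, β) = ∫₀^∞ x^{λ−1} exp(−(β/2)(x/α + α/x)) dx, and let f₀ be the GIG density f₀(x) = x^{λ−1} exp(−(β/2)(x/α + α/x)) / C(λ, α, β). If f is a probability density on (0,∞) with x·f(x), x⁻¹·f(x), (ln x)·f(x) and f(x)·ln f(x) integrable, satisfying ∫₀^∞ x f = ∫₀^∞ x f₀, ∫₀^∞ x⁻¹ f = ∫₀^∞ x⁻¹ f₀ and ∫₀^∞ ln x · f = ∫₀^∞ ln x · f₀, and if the differential entropy of f equals that of f₀, then f = f₀ almost everywhere on (0,∞). That is, the GIG density is the unique maximum-entropy density on (0,∞) with its prescribed arithmetic, geometric and harmonic means. -/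
open MeasureTheory Real Set

/-- Equality case of Gibbs' inequality for densities with respect to a measure. -/
theorem ae_eq_of_integral_mul_log_eq {X : Type*} [MeasurableSpace X] {μ : Measure X}
    {f g : X → ℝ} (hf_nonneg : ∀ᵐ x ∂μ, 0 ≤ f x) (hg_pos : ∀ᵐ x ∂μ, 0 < g x)
    (hf : Integrable f μ) (hg : Integrable g μ)
    (hff : Integrable (fun x => f x * log (f x)) μ)
    (hfg : Integrable (fun x => f x * log (g x)) μ)
    (h_mass : ∫ x, f x ∂μ = ∫ x, g x ∂μ)
    (h_log : ∫ x, f x * log (f x) ∂μ = ∫ x, f x * log (g x) ∂μ) :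
    ∀ᵐ x ∂μ, f x = g x := by
  have h_log_sub : Integrable (fun x => f x * log (f x) - f x * log (g x)) μ := hff.sub hfg
  have h_sub : Integrable (fun x => g x - f x) μ := hg.sub hf
  have h_eq : ∀ᵐ x ∂μ, f x * log (f x) - f x * log (g x) + (g x - f x)
      = g x * InformationTheory.klFun (f x / g x) := by
    filter_upwards [hf_nonneg, hg_pos] with x hfx hgx
    rw [InformationTheory.klFun]
    rcases hfx.eq_or_lt with h | h
    · simp [← h]
    · rw [log_div h.ne' hgx.ne']
      field_simp
      ring
  have h_nonneg : 0 ≤ᵐ[μ] fun x => f x * log (f x) - f x * log (g x) + (g x - f x) := by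
    filter_upwards [h_eq, hf_nonneg, hg_pos] with x hx hfx hgx
    rw [hx]
    exact mul_nonneg hgx.le (InformationTheory.klFun_nonneg (div_nonneg hfx hgx.le))
  have h_zero : ∫ x, (f x * log (f x) - f x * log (g x) + (g x - f x)) ∂μ = 0 := by
    rw [integral_add h_log_sub h_sub, integral_sub hff hfg, integral_sub hg hf,
      h_mass, h_log]
    ring
  have h_ae := (integral_eq_zero_iff_of_nonneg_ae h_nonneg (h_log_sub.add h_sub)).1 h_zero
  filter_upwards [h_ae, h_eq, hf_nonneg, hg_pos] with x h0 hx hfx hgx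
  rw [hx] at h0
  have h1 := (InformationTheory.klFun_eq_zero_iff (div_nonneg hfx hgx.le)).1
    ((mul_eq_zero.1 h0).resolve_left hgx.ne')
  exact (div_eq_one_iff_eq hgx.ne').1 h1

theorem integrableOn_rpow_mul_exp_neg_add_inv (s : ℝ) {a b : ℝ} (ha : 0 < a) (hb : 0 < b) :
    IntegrableOn (fun x : ℝ => x ^ s * exp (-(a * x) - b * x⁻¹)) (Ioi 0) := by
  obtain ⟨n, hn⟩ := exists_nat_gt (-1 - s)
  have h_dom : IntegrableOn
      (fun x : ℝ => (n.factorial / b ^ n) * (x ^ (s + n) * exp (-a * x))) (Ioi 0) := by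
    have := integrableOn_rpow_mul_exp_neg_mul_rpow (s := s + n) (by linarith) zero_lt_one ha
    simp only [rpow_one] at this
    exact this.const_mul _
  refine h_dom.mono' (by fun_prop) ?_
  filter_upwards [ae_restrict_mem measurableSet_Ioi] with x hx
  have hx : 0 < x := hx
  rw [norm_of_nonneg (by positivity), sub_eq_add_neg, exp_add, rpow_add_natCast hx.ne']
  have h_le : exp (-(b * x⁻¹)) ≤ n.factorial / b ^ n * x ^ n := by
    have h := pow_div_factorial_le_exp (b * x⁻¹) (by positivity) n
    rw [exp_neg]
    refine inv_le_of_inv_le₀ (by positivity) (le_trans (le_of_eq ?_) h)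
    rw [mul_pow, inv_pow]
    field_simp
  calc x ^ s * (exp (-(a * x)) * exp (-(b * x⁻¹)))
      ≤ x ^ s * (exp (-(a * x)) * (n.factorial / b ^ n * x ^ n)) := by gcongr
    _ = _ := by rw [neg_mul]; ring

theorem abs_log_le_add_inv {x : ℝ} (hx : 0 < x) : |log x| ≤ x + x⁻¹ := by
  have h1 := log_le_self hx.le
  have h2 := log_le_self (inv_pos.2 hx).le
  rw [log_inv] at h2
  rw [abs_le]
  constructor <;> linarith [inv_pos.2 hx]

theorem integrable_mul_of_log_affine {μ : Measure ℝ} {φ g : ℝ → ℝ} {a b c d : ℝ}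
    (hg : ∀ᵐ x ∂μ, log (g x) = a * log x + b * x + c * x⁻¹ + d)
    (h₀ : Integrable φ μ) (h₁ : Integrable (fun x => x * φ x) μ)
    (h₂ : Integrable (fun x => x⁻¹ * φ x) μ) (h₃ : Integrable (fun x => log x * φ x) μ) :
    Integrable (fun x => φ x * log (g x)) μ ∧
      ∫ x, φ x * log (g x) ∂μ = a * (∫ x, log x * φ x ∂μ) + b * (∫ x, x * φ x ∂μ)
        + c * (∫ x, x⁻¹ * φ x ∂μ) + d * ∫ x, φ x ∂μ := by
  have h_eq : (fun x => φ x * log (g x)) =ᵐ[μ]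
      fun x => a * (log x * φ x) + b * (x * φ x) + c * (x⁻¹ * φ x) + d * φ x := by
    filter_upwards [hg] with x hx
    rw [hx]
    ring
  have i₃ := h₃.const_mul a
  have i₁ := h₁.const_mul b
  have i₂ := h₂.const_mul c
  have i₀ := h₀.const_mul d
  refine ⟨(((i₃.add i₁).add i₂).add i₀).congr h_eq.symm, ?_⟩
  rw [integral_congr_ae h_eq, integral_add ((i₃.fun_add i₁).fun_add i₂) i₀,
    integral_add (i₃.fun_add i₁) i₂, integral_add i₃ i₁]
  simp only [integral_const_mul]

/-- Uniqueness of the GIG density as the maximum-entropy density on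
`(0,∞)` with its prescribed arithmetic, geometric and harmonic means: if a probability
density `f` satisfies the same three mean constraints as the GIG density
`f₀ x = x^(λ-1) * exp (-(β/2)(x/α + α/x)) / C(λ,α,β)` and has the same differential
entropy as `f₀`, then `f = f₀` almost everywhere on `(0,∞)`. -/
theorem gig_maxent_unique
    (lam α β : ℝ) (hα : 0 < α) (hβ : 0 < β)
    (C : ℝ)
    (hC_def : C = ∫ x in Ioi (0:ℝ), x ^ (lam - 1) * exp (-(β / 2) * (x / α + α / x)))
    (f₀ : ℝ → ℝ)
    (hf₀_def : ∀ x ∈ Ioi (0:ℝ),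
      f₀ x = x ^ (lam - 1) * exp (-(β / 2) * (x / α + α / x)) / C)
    (f : ℝ → ℝ) (hf_meas : Measurable f) (hf_nonneg : ∀ x ∈ Ioi (0:ℝ), 0 ≤ f x)
    (hf_norm : ∫ x in Ioi (0:ℝ), f x = 1)
    (hf_int₁ : IntegrableOn (fun x : ℝ => x * f x) (Ioi 0))
    (hf_int₂ : IntegrableOn (fun x : ℝ => x⁻¹ * f x) (Ioi 0))
    (hf_int₃ : IntegrableOn (fun x : ℝ => Real.log x * f x) (Ioi 0))
    (hf_int₄ : IntegrableOn (fun x : ℝ => f x * Real.log (f x)) (Ioi 0))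
    (h_arith : ∫ x in Ioi (0:ℝ), x * f x = ∫ x in Ioi (0:ℝ), x * f₀ x)
    (h_harm : ∫ x in Ioi (0:ℝ), x⁻¹ * f x = ∫ x in Ioi (0:ℝ), x⁻¹ * f₀ x)
    (h_geom : ∫ x in Ioi (0:ℝ), Real.log x * f x
      = ∫ x in Ioi (0:ℝ), Real.log x * f₀ x)
    (h_entropy : -∫ x in Ioi (0:ℝ), f x * Real.log (f x)
      = -∫ x in Ioi (0:ℝ), f₀ x * Real.log (f₀ x)) :
    ∀ᵐ x ∂(volume.restrict (Ioi (0:ℝ))), f x = f₀ x := by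
  have hexp : ∀ x : ℝ, -(β / 2) * (x / α + α / x)
      = -(β / (2 * α) * x) - (β * α / 2) * x⁻¹ := by
    intro x
    field_simp
    ring
  simp only [hexp] at hC_def hf₀_def
  have h_int (s : ℝ) : IntegrableOn
      (fun x : ℝ => x ^ s * exp (-(β / (2 * α) * x) - (β * α / 2) * x⁻¹)) (Ioi 0) :=
    integrableOn_rpow_mul_exp_neg_add_inv s (by positivity) (by positivity)
  have hC : 0 < C := by
    rw [hC_def, setIntegral_pos_iff_support_of_nonneg_ae ?_ (h_int _)]
    · refine lt_of_lt_of_le ?_ (measure_mono (s := Ioi 0) fun x hx => ⟨?_, hx⟩)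
      · simp
      · have hx : 0 < x := hx
        exact (by positivity : (0 : ℝ) < _).ne'
    · filter_upwards [ae_restrict_mem measurableSet_Ioi] with x hx
      have hx : 0 < x := hx
      simp only [Pi.zero_apply]
      positivity
  have hf₀_pos : ∀ x ∈ Ioi (0:ℝ), 0 < f₀ x := fun x hx => by
    rw [hf₀_def x hx]
    have hx : 0 < x := hx
    positivity
  have g₀ : IntegrableOn f₀ (Ioi 0) :=
    IntegrableOn.congr_fun (Integrable.div_const (h_int (lam - 1)) C)
      (fun x hx => (hf₀_def x hx).symm) measurableSet_Ioi
  have g₁ : IntegrableOn (fun x => x * f₀ x) (Ioi 0) := by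
    refine IntegrableOn.congr_fun (Integrable.div_const (h_int lam) C) (fun x hx => ?_)
      measurableSet_Ioi
    have hx' : x ≠ 0 := ne_of_gt hx
    simp only [hf₀_def x hx, rpow_sub_one hx']
    field_simp
  have g₂ : IntegrableOn (fun x => x⁻¹ * f₀ x) (Ioi 0) := by
    refine IntegrableOn.congr_fun (Integrable.div_const (h_int (lam - 1 - 1)) C) (fun x hx => ?_)
      measurableSet_Ioi
    have hx' : x ≠ 0 := ne_of_gt hx
    simp only [hf₀_def x hx, rpow_sub_one hx']
    field_simp
  have g₃ : IntegrableOn (fun x => log x * f₀ x) (Ioi 0) := by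
    refine (g₁.add g₂).mono' (measurable_log.aestronglyMeasurable.mul g₀.1) ?_
    filter_upwards [ae_restrict_mem measurableSet_Ioi] with x hx
    simp only [Pi.add_apply]
    rw [norm_mul, norm_eq_abs, norm_of_nonneg (hf₀_pos x hx).le, ← add_mul]
    exact mul_le_mul_of_nonneg_right (abs_log_le_add_inv hx) (hf₀_pos x hx).le
  have g_norm : ∫ x in Ioi (0:ℝ), f₀ x = 1 := by
    rw [setIntegral_congr_fun measurableSet_Ioi hf₀_def, integral_div, ← hC_def,
      div_self hC.ne']
  have h_log : ∀ᵐ x ∂(volume.restrict (Ioi (0:ℝ))), log (f₀ x)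
      = (lam - 1) * log x + -(β / (2 * α)) * x + -(β * α / 2) * x⁻¹ + -log C := by
    filter_upwards [ae_restrict_mem measurableSet_Ioi] with x hx
    have hx' : 0 < x := hx
    rw [hf₀_def x hx, log_div (by positivity) hC.ne', log_mul (by positivity) (by positivity),
      log_rpow hx', log_exp]
    ring
  have f_int : IntegrableOn f (Ioi 0) := by
    by_contra h
    rw [integral_undef h] at hf_norm
    exact zero_ne_one hf_norm
  obtain ⟨f_log_int, f_log⟩ := integrable_mul_of_log_affine h_log f_int hf_int₁ hf_int₂ hf_int₃
  obtain ⟨-, f₀_log⟩ := integrable_mul_of_log_affine h_log g₀ g₁ g₂ g₃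
  refine ae_eq_of_integral_mul_log_eq
    ((ae_restrict_mem measurableSet_Ioi).mono hf_nonneg)
    ((ae_restrict_mem measurableSet_Ioi).mono hf₀_pos)
    f_int g₀ hf_int₄ f_log_int (hf_norm.trans g_norm.symm) ?_
  rw [neg_inj.1 h_entropy, f₀_log, f_log, h_arith, h_harm, h_geom, hf_norm, g_norm]
end
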